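/- Let G be a finite connected simple graph on 9 vertices with 2 ≤ δ(G) ≤ Δ(G) ≤ 3. If there exist adjacent vertices u₁, u₂, both of degree 3, such that N̄(u₁) ∩ N̄(u₂) = {u₁, u₂} (i.e., u₁ and u₂ are adjacent and share no other common neighbor), then c_L(G) ≤ 2. -/

import Mathlib

/-!
Cops and robbers on a simple graph `G`.

A *configuration* consists of the positions of the `k` cops (a function
`Fin k → V`) together with the robber's position, with the cops to move.
The cops win if at some point a cop occupies the robber's vertex.
-/

namespace CopsRobbers

variable {V : Type*}

/-- From cop positions `c` and robber position `r`, with the cops to move,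
the cops (each of whom may move along an edge or stay put on the cops' turn)
can guarantee to catch the robber.  Either a cop is already on the robber,
or the cops can move so that a cop lands on the robber, or the cops can move
so that whatever (legal) move the robber then makes, the resulting
configuration is again winning for the cops. -/
inductive CopsWinFrom (G : SimpleGraph V) {k : ℕ} : (Fin k → V) → V → Prop
  | caught {c : Fin k → V} {r : V} (i : Fin k) (h : c i = r) : CopsWinFrom G c r
  | stepCatch {c : Fin k → V} {r : V} (c' : Fin k → V)
      (hmove : ∀ i, c' i = c i ∨ G.Adj (c i) (c' i))
      (i : Fin k) (h : c' i = r) : CopsWinFrom G c r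
  | step {c : Fin k → V} {r : V} (c' : Fin k → V)
      (hmove : ∀ i, c' i = c i ∨ G.Adj (c i) (c' i))
      (hnext : ∀ r', (r' = r ∨ G.Adj r r') → CopsWinFrom G c' r') :
      CopsWinFrom G c r

/-- `k` cops have a winning strategy on `G` in the ordinary game: they choose
starting positions, and then whatever vertex the robber starts on, they can
catch him. -/
def CopsWin (G : SimpleGraph V) (k : ℕ) : Prop :=
  ∃ c₀ : Fin k → V, ∀ r₀ : V, CopsWinFrom G c₀ r₀

/-- The cop number `c(G)`: the least number of cops that have a winning
strategy on `G`. -/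
noncomputable def copNumber (G : SimpleGraph V) : ℕ :=
  sInf {k | CopsWin G k}

/-- The lazy variant: from cop positions `c` and robber position `r`, with the
cops to move, the cops can catch the robber, where on each cops' turn at most
one cop (cop `j`) moves along an edge (all others stay put). -/
inductive LazyWinFrom (G : SimpleGraph V) {k : ℕ} : (Fin k → V) → V → Prop
  | caught {c : Fin k → V} {r : V} (i : Fin k) (h : c i = r) : LazyWinFrom G c r
  | stepCatch {c : Fin k → V} {r : V} (c' : Fin k → V) (j : Fin k)
      (hmove : c' j = c j ∨ G.Adj (c j) (c' j))
      (hfix : ∀ i, i ≠ j → c' i = c i)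
      (i : Fin k) (h : c' i = r) : LazyWinFrom G c r
  | step {c : Fin k → V} {r : V} (c' : Fin k → V) (j : Fin k)
      (hmove : c' j = c j ∨ G.Adj (c j) (c' j))
      (hfix : ∀ i, i ≠ j → c' i = c i)
      (hnext : ∀ r', (r' = r ∨ G.Adj r r') → LazyWinFrom G c' r') :
      LazyWinFrom G c r

/-- `k` lazy cops have a winning strategy on `G`. -/
def LazyCopsWin (G : SimpleGraph V) (k : ℕ) : Prop :=
  ∃ c₀ : Fin k → V, ∀ r₀ : V, LazyWinFrom G c₀ r₀

/-- The lazy cop number `c_L(G)`. -/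
noncomputable def lazyCopNumber (G : SimpleGraph V) : ℕ :=
  sInf {k | LazyCopsWin G k}

/-- A dominating set: every vertex is in `S` or adjacent to a member of `S`. -/
def IsDominatingSet (G : SimpleGraph V) (S : Set V) : Prop :=
  ∀ v : V, v ∈ S ∨ ∃ u ∈ S, G.Adj u v

/-- The domination number `γ(G)`: the least size of a dominating set. -/
noncomputable def dominationNumber (G : SimpleGraph V) [Fintype V] : ℕ :=
  sInf {m | ∃ S : Finset V, S.card = m ∧ IsDominatingSet G ↑S}

/-- The `n × n` rooks graph `K_n □ K_n`. -/
def rooksGraph (n : ℕ) : SimpleGraph (Fin n × Fin n) :=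
  SimpleGraph.boxProd ⊤ ⊤

/-! ### Closed neighbourhood tables as bit masks

A reflexive relation on `{0, …, 8}` is stored in one natural number `s`: the pair `(i, j)` is
bit `9 * i + j`.  The functions are written directly in terms of the recursors and of the binary
operations on `ℕ` with built-in kernel support. -/

noncomputable def anyOf {α : Type*} (f : α → Bool) (l : List α) : Bool :=
  List.rec false (fun x _ ih => cond (f x) true ih) l

noncomputable def allOf {α : Type*} (f : α → Bool) (l : List α) : Bool :=
  List.rec true (fun x _ ih => cond (f x) ih false) l

/-- The `i`-th row of the table `s`, as a 9-bit mask. -/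
def row (s i : ℕ) : ℕ := Nat.land (Nat.shiftRight s (Nat.mul 9 i)) 511

def bit (s i : ℕ) : Bool := Nat.beq (Nat.land (Nat.shiftRight s i) 1) 1

def maskSub (a b : ℕ) : Bool := Nat.beq (Nat.land a b) a

abbrev labels : List ℕ := [0, 1, 2, 3, 4, 5, 6, 7, 8]

/-- `covers lo hi k p q R`: cops at `p` and `q`, to move, catch within `k + 1` moves a robber in
the set `R`, if the cops may use the adjacencies in `lo` and the robber those in `hi`. -/
noncomputable def covers (lo hi k : ℕ) : ℕ → ℕ → ℕ → Bool :=
  Nat.rec (fun p q R => maskSub R (Nat.lor (row lo p) (row lo q)))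
    (fun _ ih p q R => allOf (fun r => cond (bit R r)
      (cond (bit (Nat.lor (row lo p) (row lo q)) r) true
        (cond (anyOf (fun m => cond (bit (row lo p) m) (ih m q (row hi r)) false) labels) true
          (anyOf (fun m => cond (bit (row lo q) m) (ih p m (row hi r)) false) labels)))
      true) labels) k

/-- The number of ones of a 9-bit mask. -/
def pop (x : ℕ) : ℕ := Nat.mod (Nat.land (Nat.mul x 134480385) 4581298449) 15

/-- The bits of row `i` in the columns `2, 3, 4, 5`. -/
def midBits (s i : ℕ) : ℕ := Nat.land (Nat.shiftRight s (Nat.add (Nat.mul 9 i) 2)) 15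

/-- No admissible table between `lo` and `hi` exists, because of the degrees of `p` and `q` or
of the order of the last three rows. -/
def infeasible (lo hi p q : ℕ) : Bool :=
  cond (Nat.ble 5 (pop (row lo p))) true
  (cond (Nat.ble 5 (pop (row lo q))) true
  (cond (Nat.ble (pop (row hi p)) 2) true
  (cond (Nat.ble (pop (row hi q)) 2) true
  (cond (Nat.ble (midBits lo 6) (midBits hi 7))
    (cond (Nat.ble (midBits lo 7) (midBits hi 8)) false true) true))))

/-- Starting positions that win within two moves for most tables. -/
abbrev starts : List (ℕ × ℕ) :=
  [(1, 6), (0, 8), (2, 8), (1, 2), (3, 5), (0, 6), (0, 4), (3, 4), (0, 5), (0, 7), (0, 1),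
    (1, 3), (0, 2), (0, 3), (2, 4), (2, 5), (1, 4)]

noncomputable def settled (lo hi : ℕ) : Bool :=
  cond (maskSub (Nat.lor (row hi 6) (Nat.lor (row hi 7) (row hi 8))) 448) true
  (cond (anyOf (fun s => covers lo hi 1 s.1 s.2 511) starts) true
  (cond (covers lo hi 2 0 1 511) true
  (cond (covers lo hi 3 0 1 511) true
  (covers lo hi 4 0 1 511))))

def edgeMask (p q : ℕ) : ℕ :=
  Nat.lor (Nat.pow 2 (Nat.add (Nat.mul 9 p) q)) (Nat.pow 2 (Nat.add (Nat.mul 9 q) p))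

def eraseMask (s m : ℕ) : ℕ := Nat.xor s (Nat.land s m)

/-- Applies `f` to the evaluated form of `x`. -/
noncomputable def force (f : ℕ → Bool) (x : ℕ) : Bool :=
  Nat.rec (f 0) (fun n _ => f (Nat.succ n)) x

/-- Every admissible table between `lo` and `hi` is settled; branch on the listed edges. -/
noncomputable def search (es : List (ℕ × ℕ)) : ℕ → ℕ → Bool :=
  List.rec (fun lo hi => force (fun lo => force (fun hi => settled lo hi) hi) lo)
    (fun e _ ih lo hi =>
      cond (cond (infeasible (Nat.lor lo (edgeMask e.1 e.2)) hi e.1 e.2) true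
          (ih (Nat.lor lo (edgeMask e.1 e.2)) hi))
        (cond (infeasible lo (eraseMask hi (edgeMask e.1 e.2)) e.1 e.2) true
          (ih lo (eraseMask hi (edgeMask e.1 e.2)))) false) es

/-- The edges of the double star with centres `0, 1` and leaves `2, 3` and `4, 5`. -/
abbrev starTable : ℕ := 1210107565354358003754511

/-- `starTable` together with all pairs in `{2, …, 8}`. -/
abbrev fullTable : ℕ := 2403656815586089960236559

abbrev freeEdges : List (ℕ × ℕ) :=
  [(2, 8), (3, 8), (4, 8), (5, 8), (2, 7), (3, 7), (4, 7), (5, 7), (2, 6), (3, 6), (4, 6),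
    (5, 6), (6, 7), (6, 8), (7, 8), (2, 3), (2, 4), (2, 5), (3, 4), (3, 5), (4, 5)]

/-! ### Correctness of the mask operations -/

theorem anyOf_iff {α : Type*} {f : α → Bool} {l : List α} :
    anyOf f l = true ↔ ∃ x ∈ l, f x = true := by
  induction l with
  | nil => simp [anyOf]
  | cons a l ih =>
    have h : anyOf f (a :: l) = cond (f a) true (anyOf f l) := rfl
    rw [h]
    cases hf : f a <;> simp [hf, ih]

theorem allOf_iff {α : Type*} {f : α → Bool} {l : List α} :
    allOf f l = true ↔ ∀ x ∈ l, f x = true := by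
  induction l with
  | nil => simp [allOf]
  | cons a l ih =>
    have h : allOf f (a :: l) = cond (f a) (allOf f l) false := rfl
    rw [h]
    cases hf : f a <;> simp [hf, ih]

theorem force_eq (f : ℕ → Bool) (x : ℕ) : force f x = f x := by
  cases x <;> rfl

theorem mem_labels {i : ℕ} : i ∈ labels ↔ i < 9 := by
  simp only [labels, List.mem_cons, List.not_mem_nil, or_false]
  omega

theorem bit_eq_testBit (s i : ℕ) : bit s i = s.testBit i := by
  have h : bit s i = Nat.beq (s >>> i &&& 1) 1 := rfl
  rw [h, Bool.eq_iff_iff, Nat.beq_eq, Nat.and_one_is_mod, Nat.testBit_eq_decide_div_mod_eq,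
    Nat.shiftRight_eq_div_pow, decide_eq_true_eq]

theorem testBit_row (s i j : ℕ) :
    (row s i).testBit j = (decide (j < 9) && s.testBit (9 * i + j)) := by
  have h : row s i = (s >>> (9 * i)) &&& (2 ^ 9 - 1) := rfl
  rw [h, Nat.testBit_and, Nat.testBit_two_pow_sub_one, Nat.testBit_shiftRight, Bool.and_comm]

theorem row_lt (s i : ℕ) : row s i < 512 :=
  lt_of_le_of_lt (Nat.and_le_right (n := s >>> (9 * i)) (m := 511)) (by norm_num)

theorem testBit_midBits (s i j : ℕ) :
    (midBits s i).testBit j = (decide (j < 4) && s.testBit (9 * i + 2 + j)) := by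
  have h : midBits s i = (s >>> (9 * i + 2)) &&& (2 ^ 4 - 1) := rfl
  rw [h, Nat.testBit_and, Nat.testBit_two_pow_sub_one, Nat.testBit_shiftRight, Bool.and_comm]

/-- Bitwise inclusion. -/
def BitSub (a b : ℕ) : Prop := ∀ k, a.testBit k = true → b.testBit k = true

theorem BitSub.le {a b : ℕ} (h : BitSub a b) : a ≤ b := by
  have : a &&& b = a := Nat.eq_of_testBit_eq fun k => by
    have := h k
    rw [Nat.testBit_and]
    cases ha : a.testBit k <;> simp_all
  rw [← this]
  exact Nat.and_le_right

theorem maskSub_iff {a b : ℕ} : maskSub a b = true ↔ BitSub a b := by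
  have h : maskSub a b = Nat.beq (a &&& b) a := rfl
  rw [h, Nat.beq_eq]
  constructor
  · intro h k hk
    rw [← h, Nat.testBit_and] at hk
    simp_all
  · intro h
    refine Nat.eq_of_testBit_eq fun k => ?_
    have := h k
    rw [Nat.testBit_and]
    cases ha : a.testBit k <;> simp_all

theorem BitSub.row {a b : ℕ} (h : BitSub a b) (i : ℕ) : BitSub (row a i) (row b i) := by
  intro k
  simp only [testBit_row, Bool.and_eq_true]
  exact fun hk => ⟨hk.1, h _ hk.2⟩

theorem BitSub.midBits {a b : ℕ} (h : BitSub a b) (i : ℕ) :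
    BitSub (midBits a i) (midBits b i) := by
  intro k
  simp only [testBit_midBits, Bool.and_eq_true]
  exact fun hk => ⟨hk.1, h _ hk.2⟩

theorem pop_eq_sum {x : ℕ} (hx : x < 512) : pop x = ∑ j : Fin 9, (x.testBit j).toNat := by
  have h : ∀ x < 512, pop x = (x.testBit 0).toNat + (x.testBit 1).toNat + (x.testBit 2).toNat +
      (x.testBit 3).toNat + (x.testBit 4).toNat + (x.testBit 5).toNat + (x.testBit 6).toNat +
      (x.testBit 7).toNat + (x.testBit 8).toNat := by decide +kernel
  rw [h x hx, Fin.sum_univ_castSucc, Fin.sum_univ_eight]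
  rfl

theorem BitSub.pop_row_le {a b : ℕ} (h : BitSub a b) (i : ℕ) :
    pop (CopsRobbers.row a i) ≤ pop (CopsRobbers.row b i) := by
  rw [pop_eq_sum (row_lt a i), pop_eq_sum (row_lt b i)]
  refine Finset.sum_le_sum fun j _ => ?_
  cases ha : (CopsRobbers.row a i).testBit j with
  | false => exact Nat.zero_le _
  | true => rw [h.row i j ha]

theorem testBit_edgeMask {p q k : ℕ} :
    (edgeMask p q).testBit k = true ↔ k = 9 * p + q ∨ k = 9 * q + p := by
  have h : edgeMask p q = 2 ^ (9 * p + q) ||| 2 ^ (9 * q + p) := rfl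
  rw [h, Nat.testBit_or, Nat.testBit_two_pow, Nat.testBit_two_pow,
    Bool.or_eq_true, decide_eq_true_eq, decide_eq_true_eq, eq_comm, @eq_comm _ (9 * q + p)]

theorem testBit_eraseMask {s m k : ℕ} :
    (eraseMask s m).testBit k = (s.testBit k && !m.testBit k) := by
  have h : eraseMask s m = s ^^^ (s &&& m) := rfl
  rw [h, Nat.testBit_xor, Nat.testBit_and]
  cases s.testBit k <;> cases m.testBit k <;> rfl

/-! ### Correctness of the search -/

/-- The conditions on a table that the search uses. -/
structure Admissible (T : ℕ) : Prop where
  symm : ∀ p q, p < 9 → q < 9 → T.testBit (9 * p + q) = T.testBit (9 * q + p)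
  le_pop : ∀ i < 9, 3 ≤ pop (row T i)
  pop_le : ∀ i < 9, pop (row T i) ≤ 4
  midBits_le₁ : midBits T 6 ≤ midBits T 7
  midBits_le₂ : midBits T 7 ≤ midBits T 8
  leaves : ¬ BitSub (row T 6 ||| (row T 7 ||| row T 8)) 448

theorem Admissible.infeasible_eq_false {T lo hi p q : ℕ} (hT : Admissible T)
    (hlo : BitSub lo T) (hhi : BitSub T hi) (hp : p < 9) (hq : q < 9) :
    infeasible lo hi p q = false := by
  have hb : ∀ m n : ℕ, n < m → Nat.ble m n = false := fun m n h => by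
    rw [Bool.eq_false_iff, ne_eq, Nat.ble_eq]; omega
  have h1 := hb 5 (pop (row lo p)) (by have := hlo.pop_row_le p; have := hT.pop_le p hp; omega)
  have h2 := hb 5 (pop (row lo q)) (by have := hlo.pop_row_le q; have := hT.pop_le q hq; omega)
  have h3 := hb (pop (row hi p)) 2 (by have := hhi.pop_row_le p; have := hT.le_pop p hp; omega)
  have h4 := hb (pop (row hi q)) 2 (by have := hhi.pop_row_le q; have := hT.le_pop q hq; omega)
  have h5 : Nat.ble (midBits lo 6) (midBits hi 7) = true :=
    Nat.ble_eq.symm ▸ ((hlo.midBits 6).le.trans (hT.midBits_le₁.trans (hhi.midBits 7).le))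
  have h6 : Nat.ble (midBits lo 7) (midBits hi 8) = true :=
    Nat.ble_eq.symm ▸ ((hlo.midBits 7).le.trans (hT.midBits_le₂.trans (hhi.midBits 8).le))
  simp only [infeasible, h1, h2, h3, h4, h5, h6, cond_true, cond_false]

theorem Admissible.exists_covers_of_settled {T lo hi : ℕ} (hT : Admissible T)
    (hhi : BitSub T hi) (h : settled lo hi = true) :
    ∃ k p q, p < 9 ∧ q < 9 ∧ covers lo hi k p q 511 = true := by
  have h0 : maskSub (Nat.lor (row hi 6) (Nat.lor (row hi 7) (row hi 8))) 448 = false := by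
    rw [Bool.eq_false_iff, ne_eq, maskSub_iff]
    refine fun h => hT.leaves fun k hk => h k ?_
    change (row hi 6 ||| (row hi 7 ||| row hi 8)).testBit k = true
    simp only [Nat.testBit_or, Bool.or_eq_true] at hk ⊢
    exact hk.imp (hhi.row 6 k) (Or.imp (hhi.row 7 k) (hhi.row 8 k))
  simp only [settled, h0, Bool.cond_eq_ite, ite_eq_left_iff, anyOf_iff, Bool.false_eq_true,
    ite_false] at h
  have hs : ∀ s ∈ starts, s.1 < 9 ∧ s.2 < 9 := by decide
  by_cases h1 : ∃ x ∈ starts, covers lo hi 1 x.1 x.2 511 = true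
  · obtain ⟨s, hm, hc⟩ := h1
    exact ⟨1, s.1, s.2, (hs s hm).1, (hs s hm).2, hc⟩
  by_cases h2 : covers lo hi 2 0 1 511 = true
  · exact ⟨2, 0, 1, by norm_num, by norm_num, h2⟩
  by_cases h3 : covers lo hi 3 0 1 511 = true
  · exact ⟨3, 0, 1, by norm_num, by norm_num, h3⟩
  exact ⟨4, 0, 1, by norm_num, by norm_num, h h1 h2 h3⟩

theorem Admissible.exists_covers {T : ℕ} (hT : Admissible T) {es : List (ℕ × ℕ)}
    (hes : ∀ e ∈ es, e.1 < 9 ∧ e.2 < 9) {lo hi : ℕ} (hlo : BitSub lo T) (hhi : BitSub T hi)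
    (h : search es lo hi = true) :
    ∃ lo hi k p q, BitSub lo T ∧ BitSub T hi ∧ p < 9 ∧ q < 9 ∧
      covers lo hi k p q 511 = true := by
  induction es generalizing lo hi with
  | nil =>
    have h' : force (fun lo => force (fun hi => settled lo hi) hi) lo = true := h
    rw [force_eq, force_eq] at h'
    obtain ⟨k, p, q, hp, hq, hc⟩ := hT.exists_covers_of_settled hhi h'
    exact ⟨lo, hi, k, p, q, hlo, hhi, hp, hq, hc⟩
  | cons e es ih =>
    obtain ⟨he1, he2⟩ := hes e List.mem_cons_self
    have h' : cond (cond (infeasible (Nat.lor lo (edgeMask e.1 e.2)) hi e.1 e.2) true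
          (search es (Nat.lor lo (edgeMask e.1 e.2)) hi))
        (cond (infeasible lo (eraseMask hi (edgeMask e.1 e.2)) e.1 e.2) true
          (search es lo (eraseMask hi (edgeMask e.1 e.2)))) false = true := h
    have hes' : ∀ e ∈ es, e.1 < 9 ∧ e.2 < 9 := fun e h => hes e (List.mem_cons_of_mem _ h)
    have hsymm := hT.symm e.1 e.2 he1 he2
    rw [Bool.cond_false_right, Bool.and_eq_true] at h'
    by_cases hb : T.testBit (9 * e.1 + e.2) = true
    · have hlo' : BitSub (Nat.lor lo (edgeMask e.1 e.2)) T := by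
        intro k hk
        replace hk : (lo ||| edgeMask e.1 e.2).testBit k = true := hk
        rw [Nat.testBit_or, Bool.or_eq_true, testBit_edgeMask] at hk
        rcases hk with hk | rfl | rfl
        exacts [hlo k hk, hb, hsymm ▸ hb]
      have h1 := h'.1
      rw [hT.infeasible_eq_false hlo' hhi he1 he2] at h1
      exact ih hes' hlo' hhi h1
    · have hhi' : BitSub T (eraseMask hi (edgeMask e.1 e.2)) := by
        intro k hk
        rw [testBit_eraseMask, hhi k hk, Bool.true_and, Bool.not_eq_true', Bool.eq_false_iff,
          ne_eq, testBit_edgeMask]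
        rintro (rfl | rfl)
        exacts [hb hk, hb (hsymm ▸ hk)]
      have h2 := h'.2
      rw [hT.infeasible_eq_false hlo hhi' he1 he2] at h2
      exact ih hes' hlo hhi' h2

section

/-! ### From tables to the game -/

variable {G : SimpleGraph V}

theorem LazyWinFrom.step_left {a b m r : V} (hm : m = a ∨ G.Adj a m)
    (h : ∀ r', (r' = r ∨ G.Adj r r') → LazyWinFrom G ![m, b] r') : LazyWinFrom G ![a, b] r :=
  .step ![m, b] 0 (by simpa using hm) (fun i hi => by fin_cases i <;> simp_all) h

theorem LazyWinFrom.step_right {a b m r : V} (hm : m = b ∨ G.Adj b m)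
    (h : ∀ r', (r' = r ∨ G.Adj r r') → LazyWinFrom G ![a, m] r') : LazyWinFrom G ![a, b] r :=
  .step ![a, m] 1 (by simpa using hm) (fun i hi => by fin_cases i <;> simp_all) h

theorem LazyWinFrom.catch_left {a b r : V} (hm : r = a ∨ G.Adj a r) :
    LazyWinFrom G ![a, b] r :=
  .stepCatch ![r, b] 0 (by simpa using hm) (fun i hi => by fin_cases i <;> simp_all) 0 rfl

theorem LazyWinFrom.catch_right {a b r : V} (hm : r = b ∨ G.Adj b r) :
    LazyWinFrom G ![a, b] r :=
  .stepCatch ![a, r] 1 (by simpa using hm) (fun i hi => by fin_cases i <;> simp_all) 1 rfl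

theorem lazyWinFrom_of_covers {f : ℕ → V} {lo hi : ℕ}
    (hlo : ∀ i j, i < 9 → (row lo i).testBit j = true → f j = f i ∨ G.Adj (f i) (f j))
    (hhi : ∀ i v, i < 9 → (v = f i ∨ G.Adj (f i) v) →
      ∃ j < 9, f j = v ∧ (row hi i).testBit j = true)
    {k p q R r : ℕ} (h : covers lo hi k p q R = true) (hp : p < 9) (hq : q < 9) (hr : r < 9)
    (hR : R.testBit r = true) : LazyWinFrom G ![f p, f q] (f r) := by
  have dominated : ∀ {p q r : ℕ}, p < 9 → q < 9 →
      (Nat.lor (row lo p) (row lo q)).testBit r = true → LazyWinFrom G ![f p, f q] (f r) := by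
    intro p q r hp hq h
    replace h : (row lo p ||| row lo q).testBit r = true := h
    rw [Nat.testBit_or, Bool.or_eq_true] at h
    rcases h with h | h
    exacts [.catch_left (hlo p r hp h), .catch_right (hlo q r hq h)]
  induction k generalizing p q R r with
  | zero => exact dominated hp hq (maskSub_iff.1 h r hR)
  | succ k ih =>
    have h' : allOf (fun r => cond (bit R r)
      (cond (bit (Nat.lor (row lo p) (row lo q)) r) true
        (cond (anyOf (fun m => cond (bit (row lo p) m) (covers lo hi k m q (row hi r)) false)
            labels) true
          (anyOf (fun m => cond (bit (row lo q) m) (covers lo hi k p m (row hi r)) false)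
            labels))) true) labels = true := h
    rw [allOf_iff] at h'
    have h1 := h' r (mem_labels.2 hr)
    rw [bit_eq_testBit, hR, cond_true, bit_eq_testBit, Bool.cond_true_left, Bool.or_eq_true,
      Bool.cond_true_left, Bool.or_eq_true, anyOf_iff, anyOf_iff] at h1
    rcases h1 with h1 | ⟨m, hm, h1⟩ | ⟨m, hm, h1⟩
    · exact dominated hp hq h1
    · rw [Bool.cond_false_right, Bool.and_eq_true, bit_eq_testBit] at h1
      refine .step_left (hlo p m hp h1.1) fun r' hr' => ?_
      obtain ⟨j, hj, rfl, hb⟩ := hhi r r' hr hr'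
      exact ih h1.2 (mem_labels.1 hm) hq hj hb
    · rw [Bool.cond_false_right, Bool.and_eq_true, bit_eq_testBit] at h1
      refine .step_right (hlo q m hq h1.1) fun r' hr' => ?_
      obtain ⟨j, hj, rfl, hb⟩ := hhi r r' hr hr'
      exact ih h1.2 hp (mem_labels.1 hm) hj hb

end

theorem search_freeEdges : search freeEdges starTable fullTable = true := by
  decide +kernel

section

open Classical in
theorem exists_neighbors_of_degree_eq_three {V : Type*} [Fintype V] {G : SimpleGraph V}
    [DecidableRel G.Adj] {u w : V} (hu : G.degree u = 3) (huw : G.Adj u w) :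
    ∃ a b, a ≠ b ∧ a ≠ w ∧ b ≠ w ∧ ∀ v, G.Adj u v ↔ v = w ∨ v = a ∨ v = b := by
  have hw : w ∈ G.neighborFinset u := (G.mem_neighborFinset u w).2 huw
  have hc : ((G.neighborFinset u).erase w).card = 2 := by
    rw [Finset.card_erase_of_mem hw, G.card_neighborFinset_eq_degree, hu]
  obtain ⟨a, b, hab, he⟩ := Finset.card_eq_two.1 hc
  have hm : ∀ v, (v ≠ w ∧ G.Adj u v) ↔ v = a ∨ v = b := fun v => by
    have := Finset.ext_iff.1 he v
    simpa using this
  refine ⟨a, b, hab, ((hm a).2 (.inl rfl)).1, ((hm b).2 (.inr rfl)).1, fun v => ?_⟩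
  have := hm v
  by_cases hv : v = w
  · simp [hv, huw]
  · simpa [hv] using this

theorem exists_perm_monotone_three {α : Type*} (f : α → ℕ) (x y z : α) :
    ∃ x' y' z', f x' ≤ f y' ∧ f y' ≤ f z' ∧ [x', y', z'].Perm [x, y, z] := by
  rcases le_total (f x) (f y) with h1 | h1 <;> rcases le_total (f y) (f z) with h2 | h2 <;>
    rcases le_total (f x) (f z) with h3 | h3
  · exact ⟨x, y, z, h1, h2, .refl _⟩
  · exact ⟨x, y, z, h1, h2, .refl _⟩
  · exact ⟨x, z, y, h3, h2, .cons _ (.swap _ _ _)⟩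
  · exact ⟨z, x, y, h3, h1, (List.Perm.swap x z [y]).trans (.cons _ (.swap _ _ _))⟩
  · exact ⟨y, x, z, h1, h3, .swap _ _ _⟩
  · exact ⟨y, z, x, h2, h3, ((List.Perm.swap x z []).cons y).trans (.swap _ _ _)⟩
  · exact ⟨z, y, x, h2, h1, List.reverse_perm [x, y, z]⟩
  · exact ⟨z, y, x, h2, h1, List.reverse_perm [x, y, z]⟩

open Classical in
/-- The adjacencies of `v` with four given vertices, as a 4-bit mask. -/
noncomputable def adjMask {V : Type*} (G : SimpleGraph V) (a b c d v : V) : ℕ :=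
  Nat.ofBits fun k : Fin 4 => decide (G.Adj v (![a, b, c, d] k))

open Classical in
theorem exists_labelling {V : Type*} [Fintype V] {G : SimpleGraph V}
    [DecidableRel G.Adj] (hcard : Fintype.card V = 9) {u₁ u₂ : V} (h1 : G.degree u₁ = 3)
    (h2 : G.degree u₂ = 3) (hadj : G.Adj u₁ u₂)
    (hN : insert u₁ (G.neighborSet u₁) ∩ insert u₂ (G.neighborSet u₂) = {u₁, u₂}) :
    ∃ e : Fin 9 ≃ V, (∀ v, G.Adj (e 0) v ↔ v = e 1 ∨ v = e 2 ∨ v = e 3) ∧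
      (∀ v, G.Adj (e 1) v ↔ v = e 0 ∨ v = e 4 ∨ v = e 5) ∧
      adjMask G (e 2) (e 3) (e 4) (e 5) (e 6) ≤ adjMask G (e 2) (e 3) (e 4) (e 5) (e 7) ∧
      adjMask G (e 2) (e 3) (e 4) (e 5) (e 7) ≤ adjMask G (e 2) (e 3) (e 4) (e 5) (e 8) := by
  obtain ⟨a, b, hab, ha, hb, hu₁⟩ := exists_neighbors_of_degree_eq_three h1 hadj
  obtain ⟨c, d, hcd, hc, hd, hu₂⟩ := exists_neighbors_of_degree_eq_three h2 hadj.symm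
  have hN' : ∀ v, G.Adj u₁ v → G.Adj u₂ v → False := by
    intro v hv₁ hv₂
    have : v ∈ ({u₁, u₂} : Set V) := hN ▸ ⟨.inr hv₁, .inr hv₂⟩
    rcases this with rfl | rfl
    exacts [hv₁.ne rfl, hv₂.ne rfl]
  have hau : G.Adj u₁ a := (hu₁ a).2 (by simp)
  have hbu : G.Adj u₁ b := (hu₁ b).2 (by simp)
  have hcu : G.Adj u₂ c := (hu₂ c).2 (by simp)
  have hdu : G.Adj u₂ d := (hu₂ d).2 (by simp)
  have hnd : [u₁, u₂, a, b, c, d].Nodup := by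
    simp only [List.nodup_cons, List.mem_cons, List.not_mem_nil, not_or, or_false,
      not_false_eq_true, List.nodup_nil, and_true]
    refine ⟨⟨hadj.ne, hau.ne, hbu.ne, hc.symm, hd.symm⟩, ⟨ha.symm, hb.symm, hcu.ne, hdu.ne⟩,
      ⟨hab, ?_, ?_⟩, ⟨?_, ?_⟩, hcd⟩ <;> rintro rfl
    exacts [hN' _ hau hcu, hN' _ hau hdu, hN' _ hbu hcu, hN' _ hbu hdu]
  have hW : ([u₁, u₂, a, b, c, d].toFinsetᶜ).card = 3 := by
    rw [Finset.card_compl, List.toFinset_card_of_nodup hnd, hcard]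
    rfl
  obtain ⟨x, y, z, hxy, hxz, hyz, hW⟩ := Finset.card_eq_three.1 hW
  obtain ⟨x', y', z', hle₁, hle₂, hperm⟩ := exists_perm_monotone_three (adjMask G a b c d) x y z
  have hnd' : ([u₁, u₂, a, b, c, d] ++ [x', y', z']).Nodup := by
    refine List.nodup_append'.2 ⟨hnd, hperm.nodup_iff.2 (by simp [hxy, hxz, hyz]), ?_⟩
    intro v hv hv'
    have hv'' : v ∈ ({x, y, z} : Finset V) := by simpa using hperm.mem_iff.1 hv'
    rw [← hW, Finset.mem_compl, List.mem_toFinset] at hv''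
    exact hv'' hv
  have hinj := List.nodup_iff_injective_get.1 hnd'
  let e : Fin 9 ≃ V := Equiv.ofBijective
    (fun i : Fin 9 => ([u₁, u₂, a, b, c, d] ++ [x', y', z']).get i)
    ((Fintype.bijective_iff_injective_and_card _).2 ⟨hinj, by simp [hcard]⟩)
  exact ⟨e, hu₁, hu₂, hle₁, hle₂⟩

open Classical in
/-- The table of closed neighbourhoods of `G` in the labelling `e`. -/
noncomputable def tableOf {V : Type*} (G : SimpleGraph V) (e : Fin 9 ≃ V) : ℕ :=
  Nat.ofBits fun k : Fin 81 =>
    decide (e (Fin.ofNat 9 (k % 9)) = e (Fin.ofNat 9 (k / 9)) ∨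
      G.Adj (e (Fin.ofNat 9 (k / 9))) (e (Fin.ofNat 9 (k % 9))))

theorem testBit_tableOf {V : Type*} {G : SimpleGraph V} {e : Fin 9 ≃ V} (i j : Fin 9) :
    (tableOf G e).testBit (9 * i + j) = true ↔ e j = e i ∨ G.Adj (e i) (e j) := by
  have h1 : (9 * (i : ℕ) + j) / 9 = i := by omega
  have h2 : (9 * (i : ℕ) + j) % 9 = j := by omega
  rw [tableOf, Nat.testBit_ofBits_lt _ _ (by omega)]
  simp [h1, h2]

theorem testBit_row_tableOf {V : Type*} {G : SimpleGraph V} {e : Fin 9 ≃ V} (i j : Fin 9) :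
    (row (tableOf G e) i).testBit j = true ↔ e j = e i ∨ G.Adj (e i) (e j) := by
  rw [testBit_row, ← testBit_tableOf]
  simp

theorem testBit_tableOf_ge {V : Type*} {G : SimpleGraph V} {e : Fin 9 ≃ V} {k : ℕ}
    (hk : 81 ≤ k) : (tableOf G e).testBit k = false :=
  Nat.testBit_ofBits_ge _ _ hk

open Classical in
theorem pop_row_tableOf {V : Type*} [Fintype V] {G : SimpleGraph V} [DecidableRel G.Adj]
    {e : Fin 9 ≃ V} (i : Fin 9) : pop (row (tableOf G e) i) = G.degree (e i) + 1 := by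
  rw [pop_eq_sum (row_lt _ _)]
  have h : ∀ j : Fin 9, ((row (tableOf G e) i).testBit j).toNat =
      if e j ∈ insert (e i) (G.neighborFinset (e i)) then 1 else 0 := fun j => by
    have := testBit_row_tableOf (G := G) (e := e) i j
    rw [Bool.toNat, Bool.cond_eq_ite]
    simp [this]
  rw [Finset.sum_congr rfl fun j _ => h j,
    Equiv.sum_comp e fun v => if v ∈ insert (e i) (G.neighborFinset (e i)) then 1 else 0]
  simp only [Finset.sum_ite_mem, Finset.univ_inter, Finset.sum_const, smul_eq_mul, mul_one]
  rw [Finset.card_insert_of_notMem (by simp), G.card_neighborFinset_eq_degree]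

open Classical in
theorem midBits_tableOf {V : Type*} {G : SimpleGraph V} {e : Fin 9 ≃ V} {i : Fin 9}
    (hi : 6 ≤ i) : midBits (tableOf G e) i = adjMask G (e 2) (e 3) (e 4) (e 5) (e i) := by
  refine Nat.eq_of_testBit_eq fun k => ?_
  rw [testBit_midBits, adjMask]
  by_cases hk : k < 4
  · rw [Nat.testBit_ofBits_lt _ _ hk, decide_eq_true hk, Bool.true_and, Bool.eq_iff_iff,
      decide_eq_true_eq, add_assoc]
    have h := testBit_tableOf (G := G) (e := e) i ⟨2 + k, by omega⟩
    have hne : (⟨2 + k, by omega⟩ : Fin 9) ≠ i := by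
      intro h
      rw [← h, Fin.le_def] at hi
      change 6 ≤ 2 + k at hi
      omega
    rw [e.injective.eq_iff, or_iff_right hne] at h
    rw [h]
    interval_cases k <;> rfl
  · rw [Nat.testBit_ofBits_ge _ _ (by omega), decide_eq_false hk, Bool.false_and]

theorem bitSub_tableOf_iff_row {V : Type*} {G : SimpleGraph V} {e : Fin 9 ≃ V} {s : ℕ} :
    BitSub (tableOf G e) s ↔
      ∀ i j : Fin 9, (e j = e i ∨ G.Adj (e i) (e j)) → s.testBit (9 * i + j) = true := by
  refine ⟨fun h i j hij => h _ ((testBit_tableOf i j).2 hij), fun h k hk => ?_⟩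
  by_cases hk81 : k < 81
  · have hd : 9 * (k / 9) + k % 9 = k := by omega
    have := h ⟨k / 9, by omega⟩ ⟨k % 9, by omega⟩
    rw [← testBit_tableOf] at this
    simp only [hd] at this
    exact this hk
  · rw [testBit_tableOf_ge (by omega)] at hk
    cases hk

theorem not_bitSub_lastRows {V : Type*} {G : SimpleGraph V} (hconn : G.Connected)
    {e : Fin 9 ≃ V} :
    ¬ BitSub (row (tableOf G e) 6 ||| (row (tableOf G e) 7 ||| row (tableOf G e) 8)) 448 := by
  intro h
  have h6 : ∀ i : Fin 9, 6 ≤ i → i = 6 ∨ i = 7 ∨ i = 8 := by decide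
  have h448 : ∀ j : Fin 9, Nat.testBit 448 j = true → 6 ≤ j := by decide
  have hstep : ∀ i j : Fin 9, 6 ≤ i → G.Adj (e i) (e j) → 6 ≤ j := by
    intro i j hi hij
    have hb := (testBit_row_tableOf (G := G) (e := e) i j).2 (.inr hij)
    refine h448 j (h j ?_)
    simp only [Nat.testBit_or, Bool.or_eq_true]
    rcases h6 i hi with rfl | rfl | rfl
    exacts [.inl hb, .inr (.inl hb), .inr (.inr hb)]
  obtain ⟨w⟩ := hconn.preconnected (e 6) (e 0)
  obtain ⟨d, -, hd₁, hd₂⟩ := w.exists_boundary_dart {v | 6 ≤ e.symm v} (by simp) (by simp)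
  exact hd₂ (hstep (e.symm d.fst) (e.symm d.snd) hd₁ (by simp))

theorem admissible_tableOf {V : Type*} [Fintype V] {G : SimpleGraph V} [DecidableRel G.Adj]
    (hconn : G.Connected) (hδ : ∀ v, 2 ≤ G.degree v) (hΔ : ∀ v, G.degree v ≤ 3)
    {e : Fin 9 ≃ V}
    (hle₁ : adjMask G (e 2) (e 3) (e 4) (e 5) (e 6) ≤ adjMask G (e 2) (e 3) (e 4) (e 5) (e 7))
    (hle₂ : adjMask G (e 2) (e 3) (e 4) (e 5) (e 7) ≤ adjMask G (e 2) (e 3) (e 4) (e 5) (e 8)) :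
    Admissible (tableOf G e) where
  symm p q hp hq := by
    have h := testBit_tableOf (G := G) (e := e) ⟨p, hp⟩ ⟨q, hq⟩
    have h' := testBit_tableOf (G := G) (e := e) ⟨q, hq⟩ ⟨p, hp⟩
    rw [Bool.eq_iff_iff, h, h', G.adj_comm, eq_comm]
  le_pop i hi := by
    have := pop_row_tableOf (G := G) (e := e) ⟨i, hi⟩
    have := hδ (e ⟨i, hi⟩)
    simp only at *
    omega
  pop_le i hi := by
    have := pop_row_tableOf (G := G) (e := e) ⟨i, hi⟩
    have := hΔ (e ⟨i, hi⟩)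
    simp only at *
    omega
  midBits_le₁ := by
    have h6 := midBits_tableOf (G := G) (e := e) (i := 6) le_rfl
    have h7 := midBits_tableOf (G := G) (e := e) (i := 7) (by decide)
    exact h6.trans_le (hle₁.trans_eq h7.symm)
  midBits_le₂ := by
    have h7 := midBits_tableOf (G := G) (e := e) (i := 7) (by decide)
    have h8 := midBits_tableOf (G := G) (e := e) (i := 8) (by decide)
    exact h7.trans_le (hle₂.trans_eq h8.symm)
  leaves := not_bitSub_lastRows hconn

theorem bitSub_starTable {V : Type*} {G : SimpleGraph V} {e : Fin 9 ≃ V}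
    (h0 : ∀ v, G.Adj (e 0) v ↔ v = e 1 ∨ v = e 2 ∨ v = e 3)
    (h1 : ∀ v, G.Adj (e 1) v ↔ v = e 0 ∨ v = e 4 ∨ v = e 5) :
    BitSub starTable (tableOf G e) := by
  intro k hk
  by_cases hk81 : k < 81
  · have hd : 9 * (k / 9) + k % 9 = k := by omega
    have hall : ∀ i j : Fin 9, starTable.testBit (9 * i + j) = true →
        i = j ∨ (i = 0 ∧ (j = 1 ∨ j = 2 ∨ j = 3)) ∨ (j = 0 ∧ (i = 1 ∨ i = 2 ∨ i = 3)) ∨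
        (i = 1 ∧ (j = 0 ∨ j = 4 ∨ j = 5)) ∨ (j = 1 ∧ (i = 0 ∨ i = 4 ∨ i = 5)) := by
      decide +kernel
    have := testBit_tableOf (G := G) (e := e) ⟨k / 9, by omega⟩ ⟨k % 9, by omega⟩
    simp only [hd] at this
    rw [this]
    have hij := hall ⟨k / 9, by omega⟩ ⟨k % 9, by omega⟩ (by simpa only [hd] using hk)
    generalize (⟨k / 9, _⟩ : Fin 9) = i at hij
    generalize (⟨k % 9, _⟩ : Fin 9) = j at hij
    rcases hij with rfl | ⟨rfl, h⟩ | ⟨rfl, h⟩ | ⟨rfl, h⟩ | ⟨rfl, h⟩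
    · exact .inl rfl
    · exact .inr ((h0 _).2 (by simpa using h))
    · exact .inr (((h0 _).2 (by simpa using h)).symm)
    · exact .inr ((h1 _).2 (by simpa using h))
    · exact .inr (((h1 _).2 (by simpa using h)).symm)
  · have hlt : starTable < 2 ^ k :=
      lt_of_lt_of_le (by norm_num) (Nat.pow_le_pow_right (n := 2) (by norm_num) (not_lt.1 hk81))
    rw [Nat.testBit_lt_two_pow hlt] at hk
    cases hk

theorem bitSub_fullTable {V : Type*} {G : SimpleGraph V} {e : Fin 9 ≃ V}
    (h0 : ∀ v, G.Adj (e 0) v ↔ v = e 1 ∨ v = e 2 ∨ v = e 3)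
    (h1 : ∀ v, G.Adj (e 1) v ↔ v = e 0 ∨ v = e 4 ∨ v = e 5) :
    BitSub (tableOf G e) fullTable := by
  have hall : ∀ i j : Fin 9, (i = 0 → j = i ∨ j = 1 ∨ j = 2 ∨ j = 3) →
      (j = 0 → j = i ∨ i = 1 ∨ i = 2 ∨ i = 3) → (i = 1 → j = i ∨ j = 0 ∨ j = 4 ∨ j = 5) →
      (j = 1 → j = i ∨ i = 0 ∨ i = 4 ∨ i = 5) → fullTable.testBit (9 * i + j) = true := by
    decide +kernel
  refine bitSub_tableOf_iff_row.2 fun i j hij => ?_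
  rw [e.injective.eq_iff] at hij
  refine hall i j ?_ ?_ ?_ ?_ <;> rintro rfl
  · exact hij.imp_right fun h => by simpa using (h0 _).1 h
  · exact hij.imp_right fun h => by simpa using (h0 _).1 h.symm
  · exact hij.imp_right fun h => by simpa using (h1 _).1 h
  · exact hij.imp_right fun h => by simpa using (h1 _).1 h.symm

end

/-- 9 vertices, `2 ≤ δ(G) ≤ Δ(G) ≤ 3`, and two adjacent
degree-3 vertices sharing no other common neighbor imply `c_L(G) ≤ 2`. -/
theorem lazy_le_two_of_adjacent_no_common_neighbor
    {V : Type*} [Fintype V] [Nonempty V] (G : SimpleGraph V)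
    [DecidableRel G.Adj] (hconn : G.Connected)
    (hcard : Fintype.card V = 9)
    (hδ : 2 ≤ G.minDegree) (hΔ : G.maxDegree ≤ 3)
    (u₁ u₂ : V) (h1 : G.degree u₁ = 3) (h2 : G.degree u₂ = 3)
    (hadj : G.Adj u₁ u₂)
    (hN : insert u₁ (G.neighborSet u₁) ∩ insert u₂ (G.neighborSet u₂) =
      {u₁, u₂}) :
    lazyCopNumber G ≤ 2 := by
  classical
  obtain ⟨e, h0, h1', hle₁, hle₂⟩ := exists_labelling hcard h1 h2 hadj hN
  have hT := admissible_tableOf hconn (fun v => hδ.trans (G.minDegree_le_degree v))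
    (fun v => (G.degree_le_maxDegree v).trans hΔ) hle₁ hle₂
  obtain ⟨lo, hi, k, p, q, hlo, hhi, hp, hq, hc⟩ :=
    hT.exists_covers (by decide) (bitSub_starTable h0 h1') (bitSub_fullTable h0 h1')
      search_freeEdges
  let f : ℕ → V := fun i => e (Fin.ofNat 9 i)
  have hf : ∀ i : Fin 9, f i = e i := fun i => by simp [f]
  have hwin : LazyCopsWin G 2 := by
    refine ⟨![f p, f q], fun r₀ => ?_⟩
    have hr := hf (e.symm r₀)
    rw [e.apply_symm_apply] at hr
    rw [← hr]
    refine lazyWinFrom_of_covers (lo := lo) (hi := hi) ?_ ?_ hc hp hq (e.symm r₀).isLt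
      (by generalize e.symm r₀ = i; revert i; decide)
    · intro i j hi hb
      have hj : j < 9 := by
        rw [testBit_row, Bool.and_eq_true, decide_eq_true_eq] at hb
        exact hb.1
      have h := (testBit_row_tableOf (G := G) (e := e) ⟨i, hi⟩ ⟨j, hj⟩).1 (hlo.row i j hb)
      rwa [← hf, ← hf] at h
    · intro i v hi hv
      refine ⟨e.symm v, (e.symm v).isLt, by simp [hf], hhi.row i _ ?_⟩
      refine (testBit_row_tableOf (G := G) (e := e) ⟨i, hi⟩ (e.symm v)).2 ?_
      rw [e.apply_symm_apply, ← hf]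
      exact hv
  exact Nat.sInf_le hwin

end CopsRobbers
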